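/- arXiv:1708.09378 — 6 statements merged into one kernel-verified Lean document; each statement's English description precedes it below -/
import Mathlib

section
/- Let d ≥ 1. For every pair (σ,τ) ∈ S_d × S_d there exists τ' ∈ S_d such that (σ,τ) is related to (ω, τ') by a finite sequence of moves, where ω = (d−1, d−2, …, 0) is the descending permutation. -/
namespace Coh

/-- The first `k` values `(σ_0, …, σ_{k−1})` of a permutation of `Fin d`, sorted
increasingly. -/
def sortedFirst (d : ℕ) (σ : Equiv.Perm (Fin d)) (k : ℕ) : List ℕ :=
  List.insertionSort (· ≤ ·) (((List.finRange d).take k).map fun i => (σ i : ℕ))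

/-- `(σ,τ)` is `k`-coherent: with `s`, `t` the increasing rearrangements of the first `k`
values of `σ`, `τ`, one has `s_i + t_{k−1−i} < d` for all `0 ≤ i ≤ k−1`. -/
def KCoherent (d : ℕ) (σ τ : Equiv.Perm (Fin d)) (k : ℕ) : Prop :=
  ∀ i : ℕ, i < k →
    (sortedFirst d σ k).getD i 0 + (sortedFirst d τ k).getD (k - 1 - i) 0 < d

/-- `(σ,τ)` is coherent: it is `k`-coherent for all `k = 1, …, d`. -/
def Coherent (d : ℕ) (σ τ : Equiv.Perm (Fin d)) : Prop :=
  ∀ k : ℕ, 1 ≤ k → k ≤ d → KCoherent d σ τ k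

/-- A move on a pair of permutations: if `σ_i < σ_{i+1}` exchange `τ_i` and `τ_{i+1}`,
or if `τ_i < τ_{i+1}` exchange `σ_i` and `σ_{i+1}`. -/
def IsMove (d : ℕ) (p q : Equiv.Perm (Fin d) × Equiv.Perm (Fin d)) : Prop :=
  ∃ i : ℕ, ∃ h : i + 1 < d,
    (p.1 ⟨i, by omega⟩ < p.1 ⟨i + 1, h⟩ ∧
      q = (p.1, p.2 * Equiv.swap ⟨i, by omega⟩ ⟨i + 1, h⟩)) ∨
    (p.2 ⟨i, by omega⟩ < p.2 ⟨i + 1, h⟩ ∧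
      q = (p.1 * Equiv.swap ⟨i, by omega⟩ ⟨i + 1, h⟩, p.2))

end Coh

namespace Coh

/-- An ascent of the first permutation can always be turned into a descent, if necessary after
first exchanging the corresponding entries of the second permutation. -/
theorem exists_reflTransGen_mul_swap {d : ℕ} (σ τ : Equiv.Perm (Fin d)) (i : ℕ) (h : i + 1 < d)
    (hσ : σ ⟨i, by omega⟩ < σ ⟨i + 1, h⟩) :
    ∃ τ' : Equiv.Perm (Fin d), Relation.ReflTransGen (IsMove d) (σ, τ)
      (σ * Equiv.swap ⟨i, by omega⟩ ⟨i + 1, h⟩, τ') := by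
  by_cases hτ : τ ⟨i, by omega⟩ < τ ⟨i + 1, h⟩
  · exact ⟨τ, .single ⟨i, h, .inr ⟨hτ, rfl⟩⟩⟩
  · have hne : τ ⟨i + 1, h⟩ ≠ τ ⟨i, by omega⟩ := by
      simp [τ.injective.eq_iff]
    refine ⟨τ * Equiv.swap ⟨i, by omega⟩ ⟨i + 1, h⟩,
      .tail (.single ⟨i, h, .inl ⟨hσ, rfl⟩⟩) ⟨i, h, .inr ⟨?_, rfl⟩⟩⟩
    simpa using lt_of_le_of_ne (not_lt.mp hτ) hne

/-- There is only one order-reversing permutation of `Fin d`. -/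
theorem perm_eq_of_strictAnti {d : ℕ} {σ ω : Equiv.Perm (Fin d)} (hσ : StrictAnti σ)
    (hω : StrictAnti ω) : σ = ω :=
  DFunLike.coe_injective ((hσ.range_inj hω).mp (by
    rw [σ.surjective.range_eq, ω.surjective.range_eq]))

/-- A permutation of `Fin d` is order-reversing as soon as it has no ascent at consecutive
positions. -/
theorem strictAnti_of_forall_not_lt {d : ℕ} {σ : Equiv.Perm (Fin d)}
    (hσ : ∀ (i : ℕ) (h : i + 1 < d), ¬ σ ⟨i, by omega⟩ < σ ⟨i + 1, h⟩) : StrictAnti σ := by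
  cases d with
  | zero => exact fun i => i.elim0
  | succ n =>
    refine Fin.strictAnti_iff_succ_lt.mpr fun i => lt_of_le_of_ne ?_ ?_
    · exact not_lt.mp (hσ i (by omega))
    · exact fun h => i.castSucc_lt_succ.ne' (σ.injective h)

/-- Every pair can be transformed by moves into one whose first entry is order-reversing. -/
theorem exists_reflTransGen_strictAnti {d : ℕ} (σ τ : Equiv.Perm (Fin d)) :
    ∃ σ' τ' : Equiv.Perm (Fin d), StrictAnti σ' ∧
      Relation.ReflTransGen (IsMove d) (σ, τ) (σ', τ') := by
  let f : Equiv.Perm (Fin d) → Lex (Fin d → (Fin d)ᵒᵈ) :=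
    fun σ => toLex fun i => OrderDual.toDual (σ i)
  induction σ using (InvImage.wf f wellFounded_lt).induction generalizing τ with
  | _ σ ih =>
    by_cases hσ : ∃ (i : ℕ) (h : i + 1 < d), σ ⟨i, by omega⟩ < σ ⟨i + 1, h⟩
    · obtain ⟨i, h, hlt⟩ := hσ
      obtain ⟨τ₁, h₁⟩ := exists_reflTransGen_mul_swap σ τ i h hlt
      have hdesc : f (σ * Equiv.swap ⟨i, by omega⟩ ⟨i + 1, h⟩) < f σ :=
        Pi.lex_desc (f := fun i => OrderDual.toDual (σ i)) (by simp) hlt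
      obtain ⟨σ', τ', hanti, h₂⟩ := ih _ hdesc τ₁
      exact ⟨σ', τ', hanti, h₁.trans h₂⟩
    · push Not at hσ
      exact ⟨σ, τ, strictAnti_of_forall_not_lt fun i h => (hσ i h).not_gt, .refl⟩

end Coh

open Coh in
/-- **Lemma.**  Every pair `(σ,τ)` may be transformed by a finite sequence of moves into
a pair `(ω, τ')`, where `ω` is the descending permutation. -/
theorem stmt_11 (d : ℕ) (hd : 1 ≤ d) (σ τ ω : Equiv.Perm (Fin d))
    (hω : ∀ i : Fin d, (ω i : ℕ) = d - 1 - (i : ℕ)) :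
    ∃ τ' : Equiv.Perm (Fin d), Relation.ReflTransGen (IsMove d) (σ, τ) (ω, τ') := by
  obtain ⟨σ', τ', hσ', h⟩ := exists_reflTransGen_strictAnti σ τ
  have hanti : StrictAnti ω := fun i j hij => by
    rw [Fin.lt_def] at hij ⊢
    rw [hω, hω]
    omega
  exact ⟨τ', perm_eq_of_strictAnti hσ' hanti ▸ h⟩
end

section
/- Let d ≥ 1 and let σ, τ, σ', τ' ∈ S_d. Then (A_•(σ), A_•(τ)) ∼ (A_•(σ'), A_•(τ')) if and only if (σ,τ) and (σ',τ') are related by a finite sequence of moves. -/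
namespace Coh

/-- `S < T` for finite sets: every element of `S` is less than every element of `T`. -/
def SetLt {d : ℕ} (S T : Finset (Fin d)) : Prop := ∀ x ∈ S, ∀ y ∈ T, x < y

/-- A pair of nested sequences `(A_•, B_•)` of subsets of `[d]`, encoded as a pair of
lists: both lists have the same length `s+1 ≥ 2`, start at `∅`, end at `[d]`, are
strictly increasing chains, and have levelwise equal cardinalities. -/
def IsNestPair (d : ℕ) (p : List (Finset (Fin d)) × List (Finset (Fin d))) : Prop :=
  p.1.length = p.2.length ∧ 2 ≤ p.1.length ∧
  p.1.head? = some ∅ ∧ p.2.head? = some ∅ ∧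
  p.1.getLast? = some Finset.univ ∧ p.2.getLast? = some Finset.univ ∧
  List.Chain' (· ⊂ ·) p.1 ∧ List.Chain' (· ⊂ ·) p.2 ∧
  ∀ i : ℕ, (p.1.getD i ∅).card = (p.2.getD i ∅).card

/-- `q` is obtained from `p` by deleting the `j`-th terms `A_{i_j}`, `B_{i_j}`
(for some `0 < j < s`) under condition (1) or (2) of the definition of `∼`. -/
def DelStep (d : ℕ) (p q : List (Finset (Fin d)) × List (Finset (Fin d))) : Prop :=
  ∃ (a1 : List (Finset (Fin d))) (Ap X An : Finset (Fin d)) (a2 : List (Finset (Fin d)))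
    (b1 : List (Finset (Fin d))) (Bp Y Bn : Finset (Fin d)) (b2 : List (Finset (Fin d))),
    a1.length = b1.length ∧
    p.1 = a1 ++ Ap :: X :: An :: a2 ∧ p.2 = b1 ++ Bp :: Y :: Bn :: b2 ∧
    q.1 = a1 ++ Ap :: An :: a2 ∧ q.2 = b1 ++ Bp :: Bn :: b2 ∧
    ((SetLt (X \ Ap) (An \ X) ∧ SetLt (Y \ Bp) (Bn \ Y)) ∨
      (An.card = Ap.card + 2 ∧ (SetLt (X \ Ap) (An \ X) ∨ SetLt (Y \ Bp) (Bn \ Y))))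

/-- The generating relation of `∼`: a deletion step between valid nested pairs. -/
def DelRel (d : ℕ) (p q : List (Finset (Fin d)) × List (Finset (Fin d))) : Prop :=
  IsNestPair d p ∧ IsNestPair d q ∧ DelStep d p q

/-- `A_•(σ)`: the complete nested sequence `∅ ⊂ {σ_0} ⊂ {σ_0,σ_1} ⊂ ⋯ ⊂ [d]`. -/
def Aseq (d : ℕ) (σ : Equiv.Perm (Fin d)) : List (Finset (Fin d)) :=
  (List.range (d + 1)).map fun k =>
    Finset.image σ (Finset.univ.filter fun i : Fin d => (i : ℕ) < k)

end Coh

namespace Coh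

open List

variable {d : ℕ}

/-- The concatenation of the increasing rearrangements of the successive differences of a
sequence of finite sets. -/
def blockWord : List (Finset (Fin d)) → List (Fin d)
  | A :: B :: l => (B \ A).sort (· ≤ ·) ++ blockWord (B :: l)
  | _ => []

/-- The analogue of `IsMove` for pairs of words. -/
def WordMove (p q : List (Fin d) × List (Fin d)) : Prop :=
  ∃ (u : List (Fin d)) (a b : Fin d) (v s : List (Fin d)) (c e : Fin d) (t : List (Fin d)),
    u.length = s.length ∧ p = (u ++ a :: b :: v, s ++ c :: e :: t) ∧
    ((a < b ∧ q = (u ++ a :: b :: v, s ++ e :: c :: t)) ∨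
      (c < e ∧ q = (u ++ b :: a :: v, s ++ c :: e :: t)))

theorem WordMove.symm {p q : List (Fin d) × List (Fin d)} (h : WordMove p q) :
    WordMove q p := by
  obtain ⟨u, a, b, v, s, c, e, t, hl, rfl, ⟨h, rfl⟩ | ⟨h, rfl⟩⟩ := h
  · exact ⟨u, a, b, v, s, e, c, t, hl, rfl, Or.inl ⟨h, rfl⟩⟩
  · exact ⟨u, b, a, v, s, c, e, t, hl, rfl, Or.inr ⟨h, rfl⟩⟩

theorem blockWord_append (l : List (Finset (Fin d))) (A : Finset (Fin d))
    (r : List (Finset (Fin d))) :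
    blockWord (l ++ A :: r) = blockWord (l ++ [A]) ++ blockWord (A :: r) := by
  induction l with
  | nil => simp [blockWord]
  | cons B l ih =>
    cases l with
    | nil => simp [blockWord]
    | cons C l => simpa [blockWord] using ih

theorem length_blockWord_add_card (A : Finset (Fin d)) (l : List (Finset (Fin d)))
    (B : Finset (Fin d)) (h : List.IsChain (· ⊂ ·) (A :: (l ++ [B]))) :
    (blockWord (A :: (l ++ [B]))).length + A.card = B.card := by
  induction l generalizing A with
  | nil =>
    have hAB : A ⊂ B := by simpa using h
    simpa [blockWord] using Finset.card_sdiff_add_card_eq_card hAB.1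
  | cons C l ih =>
    rw [cons_append, isChain_cons_cons] at h
    have h1 := ih C h.2
    have h2 := Finset.card_sdiff_add_card_eq_card h.1.1
    simp only [cons_append, blockWord, length_append, Finset.length_sort] at h1 ⊢
    omega

theorem length_blockWord (l : List (Finset (Fin d))) (B : Finset (Fin d))
    (r : List (Finset (Fin d))) (h : List.IsChain (· ⊂ ·) (l ++ B :: r))
    (h0 : (l ++ B :: r).head? = some ∅) :
    (blockWord (l ++ [B])).length = B.card := by
  cases l with
  | nil =>
    have : B = ∅ := by simpa using h0
    simp [blockWord, this]
  | cons A l =>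
    have hA : A = ∅ := by simpa using h0
    have h' : List.IsChain (· ⊂ ·) (A :: (l ++ [B])) := by
      have : (A :: (l ++ [B])) ++ r = (A :: l) ++ B :: r := by simp
      rw [← this] at h
      exact h.left_of_append
    simpa [hA] using length_blockWord_add_card A l B h'

theorem sort_append_sort {A X B : Finset (Fin d)} (hA : A ⊆ X) (hX : X ⊆ B)
    (h : SetLt (X \ A) (B \ X)) :
    (X \ A).sort (· ≤ ·) ++ (B \ X).sort (· ≤ ·) = (B \ A).sort (· ≤ ·) := by
  refine List.Perm.eq_of_pairwise (le := (· ≤ ·)) (fun _ _ _ _ => le_antisymm) ?_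
    (Finset.pairwise_sort _ _) ?_
  · rw [pairwise_append]
    refine ⟨Finset.pairwise_sort _ _, Finset.pairwise_sort _ _, fun x hx y hy => ?_⟩
    exact (h x (by simpa using hx) y (by simpa using hy)).le
  · rw [perm_ext_iff_of_nodup]
    · intro x
      simp only [mem_append, Finset.mem_sort, Finset.mem_sdiff]
      have := @hA x
      have := @hX x
      tauto
    · rw [nodup_append']
      refine ⟨Finset.sort_nodup _ _, Finset.sort_nodup _ _, fun x hx hy => ?_⟩
      exact lt_irrefl _ (h x (by simpa using hx) x (by simpa using hy))
    · exact Finset.sort_nodup _ _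

theorem setLt_singleton {x y : Fin d} : SetLt {x} {y} ↔ x < y := by
  simp [SetLt]

theorem exists_sdiff_eq_singleton {A X B : Finset (Fin d)} (hA : A ⊂ X) (hX : X ⊂ B)
    (h : B.card = A.card + 2) :
    ∃ x y, X \ A = {x} ∧ B \ X = {y} ∧
      ((x < y ∧ (B \ A).sort (· ≤ ·) = [x, y]) ∨ (y < x ∧ (B \ A).sort (· ≤ ·) = [y, x])) := by
  have h1 := Finset.card_lt_card hA
  have h2 := Finset.card_lt_card hX
  have h3 := Finset.card_sdiff_add_card_eq_card hA.1
  have h4 := Finset.card_sdiff_add_card_eq_card hX.1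
  obtain ⟨x, hx⟩ := Finset.card_eq_one.1 (show (X \ A).card = 1 by omega)
  obtain ⟨y, hy⟩ := Finset.card_eq_one.1 (show (B \ X).card = 1 by omega)
  have hxm : x ∈ X \ A := by simp [hx]
  have hym : y ∈ B \ X := by simp [hy]
  rw [Finset.mem_sdiff] at hxm hym
  refine ⟨x, y, hx, hy, ?_⟩
  have hne : x ≠ y := fun e => hym.2 (e ▸ hxm.1)
  rcases lt_or_gt_of_ne hne with hlt | hlt
  · refine Or.inl ⟨hlt, ?_⟩
    rw [← sort_append_sort hA.1 hX.1 (by rw [hx, hy]; exact setLt_singleton.2 hlt), hx, hy]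
    simp
  · refine Or.inr ⟨hlt, ?_⟩
    have hy' : (A ∪ {y}) \ A = {y} := by
      ext z
      have := @hA.1 z
      by_cases hz : z = y <;> simp_all
    have hx' : B \ (A ∪ {y}) = {x} := by
      ext z
      have e1 : z ∈ X \ A ↔ z = x := by simp [hx]
      have e2 : z ∈ B \ X ↔ z = y := by simp [hy]
      have := @hA.1 z
      have := @hX.1 z
      simp only [Finset.mem_sdiff, Finset.mem_union, Finset.mem_singleton] at e1 e2 ⊢
      by_cases hz : z = y
      · subst hz; simp [hne.symm]
      · tauto
    rw [← sort_append_sort (X := A ∪ {y}) (by simp)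
      (Finset.union_subset (hA.1.trans hX.1) (by simpa using hym.1))
      (by rw [hx', hy']; exact setLt_singleton.2 hlt), hx', hy']
    simp

theorem DelRel.reflTransGen_wordMove {p q : List (Finset (Fin d)) × List (Finset (Fin d))}
    (h : DelRel d p q) :
    Relation.ReflTransGen WordMove (blockWord p.1, blockWord p.2)
      (blockWord q.1, blockWord q.2) := by
  obtain ⟨⟨-, -, hA0, hB0, -, -, hAc, hBc, hcard⟩, -, a1, Ap, X, An, a2, b1, Bp, Y, Bn, b2, hl,
    e1, e2, e3, e4, hc⟩ := h
  rw [e1] at hA0 hAc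
  rw [e2] at hB0 hBc
  have hlen : (blockWord (a1 ++ [Ap])).length = (blockWord (b1 ++ [Bp])).length := by
    rw [length_blockWord _ _ _ hAc hA0, length_blockWord _ _ _ hBc hB0]
    have := hcard a1.length
    rw [e1, e2] at this
    simpa [getD_append_right, hl] using this
  have hn : An.card = Bn.card := by
    have := hcard (a1.length + 2)
    rw [e1, e2] at this
    simpa [getD_append_right, hl] using this
  have hp : Ap.card = Bp.card := by
    have := hcard a1.length
    rw [e1, e2] at this
    simpa [getD_append_right, hl] using this
  have hA := hAc.right_of_append
  have hB := hBc.right_of_append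
  simp only [isChain_cons_cons] at hA hB
  rw [e1, e2, e3, e4, blockWord_append a1, blockWord_append b1, blockWord_append a1 Ap (An :: a2),
    blockWord_append b1 Bp (Bn :: b2)]
  simp only [blockWord]
  rcases hc with ⟨h1, h2⟩ | ⟨h2, hc⟩
  · rw [← sort_append_sort hA.1.1 hA.2.1.1 h1, ← sort_append_sort hB.1.1 hB.2.1.1 h2]
    simp only [append_assoc]
    exact Relation.ReflTransGen.refl
  · obtain ⟨x, y, hx, hy, hxy⟩ := exists_sdiff_eq_singleton hA.1 hA.2.1 h2
    obtain ⟨z, w, hz, hw, hzw⟩ := exists_sdiff_eq_singleton hB.1 hB.2.1 (by omega)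
    rw [hx, hy, hz, hw, setLt_singleton, setLt_singleton] at hc
    rw [hx, hy, hz, hw]
    rcases hxy with ⟨hxy, e⟩ | ⟨hxy, e⟩ <;> rcases hzw with ⟨hzw, f⟩ | ⟨hzw, f⟩ <;> rw [e, f]
    · simp only [Finset.sort_singleton, cons_append, nil_append]
      exact Relation.ReflTransGen.refl
    · exact Relation.ReflTransGen.single
        ⟨_, x, y, blockWord (An :: a2), _, z, w, blockWord (Bn :: b2), hlen, by simp,
          Or.inl ⟨hxy, by simp⟩⟩
    · exact Relation.ReflTransGen.single
        ⟨_, x, y, blockWord (An :: a2), _, z, w, blockWord (Bn :: b2), hlen, by simp,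
          Or.inr ⟨hzw, by simp⟩⟩
    · exact absurd hc (by simp [hxy.le, hzw.le])

theorem reflTransGen_wordMove_of_eqvGen
    {p q : List (Finset (Fin d)) × List (Finset (Fin d))}
    (h : Relation.EqvGen (DelRel d) p q) :
    Relation.ReflTransGen WordMove (blockWord p.1, blockWord p.2)
      (blockWord q.1, blockWord q.2) := by
  induction h with
  | rel _ _ h => exact h.reflTransGen_wordMove
  | refl => exact Relation.ReflTransGen.refl
  | symm _ _ _ ih =>
    have : Std.Symm (WordMove (d := d)) := ⟨fun _ _ => WordMove.symm⟩
    exact Relation.ReflTransGen.stdSymm.symm _ _ ih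
  | trans _ _ _ _ _ ih₁ ih₂ => exact ih₁.trans ih₂

theorem ofFn_mul_swap {σ : Equiv.Perm (Fin d)} {u v : List (Fin d)} {a b : Fin d}
    (h : List.ofFn σ = u ++ a :: b :: v) {i : ℕ} (hu : u.length = i) (hi : i + 1 < d) :
    σ ⟨i, by omega⟩ = a ∧ σ ⟨i + 1, hi⟩ = b ∧
      List.ofFn (σ * Equiv.swap (⟨i, by omega⟩ : Fin d) ⟨i + 1, hi⟩) = u ++ b :: a :: v := by
  subst hu
  have key : ∀ k (hk : k < d), (u ++ a :: b :: v)[k]? = some (σ ⟨k, hk⟩) := by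
    intro k hk
    rw [← h]
    simp [hk]
  have ha : σ ⟨u.length, by omega⟩ = a := by
    have := key u.length (by omega)
    simpa using this.symm
  have hb : σ ⟨u.length + 1, hi⟩ = b := by
    have := key (u.length + 1) hi
    simpa [getElem?_append_right] using this.symm
  refine ⟨ha, hb, ?_⟩
  have hd : d = u.length + (v.length + 2) := by
    simpa using congrArg List.length h
  refine List.ext_getElem? fun k => ?_
  by_cases hk : k < d
  · rw [List.getElem?_ofFn, dif_pos hk]
    simp only [Equiv.Perm.coe_mul, Function.comp_apply]
    rcases lt_trichotomy k u.length with h1 | h1 | h1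
    · rw [Equiv.swap_apply_of_ne_of_ne (by simp; omega) (by simp; omega), ← key k hk]
      simp [getElem?_append_left, h1]
    · subst h1
      simp [hb]
    · obtain ⟨m, rfl⟩ := Nat.exists_eq_add_of_lt h1
      rcases m with _ | m
      · simp [ha]
      · rw [Equiv.swap_apply_of_ne_of_ne (by simp; omega) (by simp), ← key _ hk]
        rw [getElem?_append_right (by omega), getElem?_append_right (by omega),
          show u.length + (m + 1) + 1 - u.length = m + 1 + 1 by omega]
        simp
  · rw [getElem?_eq_none (by simpa using hk), getElem?_eq_none (by simp; omega)]

theorem WordMove.exists_isMove {σ τ : Equiv.Perm (Fin d)} {q : List (Fin d) × List (Fin d)}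
    (h : WordMove (List.ofFn σ, List.ofFn τ) q) :
    ∃ r, IsMove d (σ, τ) r ∧ q = (List.ofFn r.1, List.ofFn r.2) := by
  obtain ⟨u, a, b, v, s, c, e, t, hl, hp, hq⟩ := h
  rw [Prod.mk.injEq] at hp
  have hi : u.length + 1 < d := by
    have := congrArg List.length hp.1
    simp at this
    omega
  obtain ⟨ha, hb, hσ⟩ := ofFn_mul_swap hp.1 rfl hi
  obtain ⟨hc, he, hτ⟩ := ofFn_mul_swap hp.2 hl.symm hi
  rcases hq with ⟨h, rfl⟩ | ⟨h, rfl⟩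
  · exact ⟨_, ⟨u.length, hi, Or.inl ⟨by simpa only [ha, hb] using h, rfl⟩⟩, by rw [hτ, hp.1]⟩
  · exact ⟨_, ⟨u.length, hi, Or.inr ⟨by simpa only [hc, he] using h, rfl⟩⟩, by rw [hσ, hp.2]⟩

theorem reflTransGen_isMove_of_wordMove {σ τ : Equiv.Perm (Fin d)}
    {q : List (Fin d) × List (Fin d)}
    (h : Relation.ReflTransGen WordMove (List.ofFn σ, List.ofFn τ) q) :
    ∃ r, Relation.ReflTransGen (IsMove d) (σ, τ) r ∧ q = (List.ofFn r.1, List.ofFn r.2) := by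
  induction h with
  | refl => exact ⟨_, Relation.ReflTransGen.refl, rfl⟩
  | tail _ h ih =>
    obtain ⟨r, hr, rfl⟩ := ih
    obtain ⟨r', hr', rfl⟩ := h.exists_isMove
    exact ⟨r', hr.tail hr', rfl⟩

/-- The set of the first `k` values of `σ`. -/
def firstValues (σ : Equiv.Perm (Fin d)) (k : ℕ) : Finset (Fin d) :=
  Finset.image σ (Finset.univ.filter fun i : Fin d => (i : ℕ) < k)

theorem Aseq_eq_map (σ : Equiv.Perm (Fin d)) :
    Aseq d σ = (List.range (d + 1)).map (firstValues σ) := rfl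

theorem apply_mem_firstValues {σ : Equiv.Perm (Fin d)} {k : ℕ} {i : Fin d} :
    σ i ∈ firstValues σ k ↔ (i : ℕ) < k := by
  simp [firstValues]

theorem firstValues_succ_sdiff (σ : Equiv.Perm (Fin d)) {k : ℕ} (hk : k < d) :
    firstValues σ (k + 1) \ firstValues σ k = {σ ⟨k, hk⟩} := by
  ext x
  obtain ⟨i, rfl⟩ := σ.surjective x
  simp only [Finset.mem_sdiff, apply_mem_firstValues, Finset.mem_singleton,
    σ.injective.eq_iff, Fin.ext_iff]
  omega

theorem firstValues_ssubset (σ : Equiv.Perm (Fin d)) {k l : ℕ} (h : k < l) (hl : l ≤ d) :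
    firstValues σ k ⊂ firstValues σ l := by
  rw [Finset.ssubset_iff_of_subset]
  · exact ⟨σ ⟨k, by omega⟩, by rw [apply_mem_firstValues]; exact h,
      by rw [apply_mem_firstValues]; exact lt_irrefl k⟩
  · intro x
    obtain ⟨i, rfl⟩ := σ.surjective x
    simp only [apply_mem_firstValues]
    omega

theorem firstValues_zero (σ : Equiv.Perm (Fin d)) : firstValues σ 0 = ∅ := by
  simp [firstValues]

theorem firstValues_self (σ : Equiv.Perm (Fin d)) : firstValues σ d = Finset.univ := by
  simp [firstValues]

theorem card_firstValues (σ τ : Equiv.Perm (Fin d)) (k : ℕ) :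
    (firstValues σ k).card = (firstValues τ k).card := by
  simp [firstValues, Finset.card_image_of_injective _ (Equiv.injective _)]

theorem firstValues_mul_swap (σ : Equiv.Perm (Fin d)) {i k : ℕ} (hi : i + 1 < d)
    (hk : k ≠ i + 1) :
    firstValues (σ * Equiv.swap (⟨i, by omega⟩ : Fin d) ⟨i + 1, hi⟩) k = firstValues σ k := by
  ext x
  obtain ⟨j, rfl⟩ := (σ * Equiv.swap (⟨i, by omega⟩ : Fin d) ⟨i + 1, hi⟩).surjective x
  rw [apply_mem_firstValues, Equiv.Perm.mul_apply, apply_mem_firstValues, Equiv.swap_apply_def]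
  split_ifs with h1 h2
  · subst h1; simp only; omega
  · subst h2; simp only; omega
  · rfl

theorem blockWord_map_firstValues (σ : Equiv.Perm (Fin d)) {k : ℕ} (hk : k ≤ d) :
    blockWord ((List.range (k + 1)).map (firstValues σ)) = (List.ofFn σ).take k := by
  induction k with
  | zero => simp [blockWord]
  | succ k ih =>
    rw [List.range_succ, List.range_succ, map_append, map_append, append_assoc, map_singleton,
      map_singleton, singleton_append, blockWord_append, List.take_add_one, ← ih (by omega),
      List.range_succ, map_append, map_singleton]
    simp [blockWord, firstValues_succ_sdiff σ (show k < d by omega), show k < d by omega]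

theorem blockWord_Aseq (σ : Equiv.Perm (Fin d)) : blockWord (Aseq d σ) = List.ofFn σ := by
  rw [Aseq_eq_map, blockWord_map_firstValues σ le_rfl, take_of_length_le (by simp)]

theorem isNestPair_map_firstValues (σ τ : Equiv.Perm (Fin d)) {L : List ℕ}
    (hs : L.Sublist (List.range (d + 1))) (h2 : 2 ≤ L.length) (h0 : L.head? = some 0)
    (hd : L.getLast? = some d) :
    IsNestPair d (L.map (firstValues σ), L.map (firstValues τ)) := by
  have hc : ∀ ρ : Equiv.Perm (Fin d), List.IsChain (· ⊂ ·) (L.map (firstValues ρ)) := by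
    intro ρ
    refine List.Pairwise.isChain (List.pairwise_map.2 ?_)
    refine (List.pairwise_lt_range.sublist hs).imp_of_mem fun {k l} _ hl h => ?_
    exact firstValues_ssubset ρ h (by have := hs.subset hl; simp at this; omega)
  refine ⟨by simp, by simpa, by simp [h0, firstValues_zero], by simp [h0, firstValues_zero],
    by simp [hd, firstValues_self], by simp [hd, firstValues_self], hc σ, hc τ, fun i => ?_⟩
  by_cases hi : i < L.length
  · simpa [List.getD_eq_getElem?_getD, hi] using card_firstValues σ τ _
  · simp [List.getD_eq_getElem?_getD, getElem?_eq_none (not_lt.1 hi)]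

theorem delRel_Aseq (σ τ : Equiv.Perm (Fin d)) {i : ℕ} (hi : i + 1 < d)
    (h : σ ⟨i, by omega⟩ < σ ⟨i + 1, hi⟩ ∨ τ ⟨i, by omega⟩ < τ ⟨i + 1, hi⟩) :
    DelRel d (Aseq d σ, Aseq d τ)
      ((List.range i ++ i :: (i + 2) :: List.range' (i + 3) (d - (i + 2))).map (firstValues σ),
        (List.range i ++ i :: (i + 2) :: List.range' (i + 3) (d - (i + 2))).map
          (firstValues τ)) := by
  have hr : List.range (d + 1) =
      List.range i ++ i :: (i + 1) :: (i + 2) :: List.range' (i + 3) (d - (i + 2)) := by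
    obtain ⟨m, rfl⟩ := Nat.exists_eq_add_of_le (show i + 2 ≤ d by omega)
    rw [show i + 2 + m + 1 = i + (m + 3) by omega, List.range_add,
      ← range'_eq_map_range, show i + 2 + m - (i + 2) = m by omega, range'_succ, range'_succ,
      range'_succ]
  refine ⟨isNestPair_map_firstValues σ τ (Sublist.refl (List.range (d + 1))) (by simp; omega)
      (by simp [range_succ_eq_map]) (by simp [getLast?_range]),
    isNestPair_map_firstValues σ τ ?_ (by simp; omega) ?_ ?_, ?_⟩
  · rw [hr]
    exact (Sublist.refl _).append (((Sublist.refl _).cons _).cons_cons _)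
  · cases i <;> simp [range_succ_eq_map]
  · have hl : (List.range (d + 1)).getLast? = some d := by simp [getLast?_range]
    rw [hr] at hl
    simpa [getLast?_append, getLast?_cons] using hl
  · refine ⟨_, _, firstValues σ (i + 1), _, _, _, _, firstValues τ (i + 1), _, _, ?_, ?_, ?_,
      map_append.trans rfl, map_append.trans rfl, Or.inr ⟨?_, ?_⟩⟩
    · simp
    · simp [Aseq_eq_map, hr]
    · simp [Aseq_eq_map, hr]
    · have h1 := Finset.card_sdiff_add_card_eq_card
        (firstValues_ssubset σ (Nat.lt_add_one i) (by omega)).1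
      have h2 := Finset.card_sdiff_add_card_eq_card
        (firstValues_ssubset σ (Nat.lt_add_one (i + 1)) (by omega)).1
      rw [firstValues_succ_sdiff σ (by omega), Finset.card_singleton] at h1 h2
      change (firstValues σ (i + 1 + 1)).card = _
      omega
    · rw [firstValues_succ_sdiff σ (by omega), firstValues_succ_sdiff σ hi,
        firstValues_succ_sdiff τ (by omega), firstValues_succ_sdiff τ hi, setLt_singleton,
        setLt_singleton]
      exact h

theorem map_firstValues_mul_swap (σ : Equiv.Perm (Fin d)) {i : ℕ} (hi : i + 1 < d) :
    (List.range i ++ i :: (i + 2) :: List.range' (i + 3) (d - (i + 2))).map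
        (firstValues (σ * Equiv.swap (⟨i, by omega⟩ : Fin d) ⟨i + 1, hi⟩)) =
      (List.range i ++ i :: (i + 2) :: List.range' (i + 3) (d - (i + 2))).map
        (firstValues σ) := by
  refine List.map_congr_left fun k hk => firstValues_mul_swap σ hi ?_
  rintro rfl
  simp at hk

theorem IsMove.eqvGen_delRel {p q : Equiv.Perm (Fin d) × Equiv.Perm (Fin d)}
    (h : IsMove d p q) :
    Relation.EqvGen (DelRel d) (Aseq d p.1, Aseq d p.2) (Aseq d q.1, Aseq d q.2) := by
  obtain ⟨σ, τ⟩ := p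
  obtain ⟨i, hi, ⟨h, rfl⟩ | ⟨h, rfl⟩⟩ := h
  · have h2 := delRel_Aseq σ (τ * Equiv.swap ⟨i, by omega⟩ ⟨i + 1, hi⟩) hi (Or.inl h)
    rw [map_firstValues_mul_swap] at h2
    exact .trans _ _ _ (.rel _ _ (delRel_Aseq σ τ hi (Or.inl h))) (.symm _ _ (.rel _ _ h2))
  · have h2 := delRel_Aseq (σ * Equiv.swap (⟨i, by omega⟩ : Fin d) ⟨i + 1, hi⟩) τ hi (Or.inr h)
    rw [map_firstValues_mul_swap] at h2
    exact .trans _ _ _ (.rel _ _ (delRel_Aseq σ τ hi (Or.inr h))) (.symm _ _ (.rel _ _ h2))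

theorem eqvGen_delRel_of_reflTransGen {p q : Equiv.Perm (Fin d) × Equiv.Perm (Fin d)}
    (h : Relation.ReflTransGen (IsMove d) p q) :
    Relation.EqvGen (DelRel d) (Aseq d p.1, Aseq d p.2) (Aseq d q.1, Aseq d q.2) := by
  induction h with
  | refl => exact .refl _
  | tail _ h ih => exact .trans _ _ _ ih h.eqvGen_delRel

end Coh

open Coh in
/-- **Lemma.**  For permutations `σ, τ, σ', τ' ∈ S_d`, the pairs of complete nested
sequences `(A_•(σ), A_•(τ))` and `(A_•(σ'), A_•(τ'))` are `∼`-equivalent iff `(σ,τ)`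
and `(σ',τ')` are related by a finite sequence of moves. -/
theorem stmt_12 (d : ℕ) (hd : 1 ≤ d) (σ τ σ' τ' : Equiv.Perm (Fin d)) :
    Relation.EqvGen (DelRel d) (Aseq d σ, Aseq d τ) (Aseq d σ', Aseq d τ') ↔
      Relation.ReflTransGen (IsMove d) (σ, τ) (σ', τ') := by
  constructor
  · intro h
    have hw := reflTransGen_wordMove_of_eqvGen h
    simp only [blockWord_Aseq] at hw
    obtain ⟨⟨σ'', τ''⟩, hr, he⟩ := reflTransGen_isMove_of_wordMove hw
    rw [Prod.mk.injEq, List.ofFn_inj, List.ofFn_inj, DFunLike.coe_fn_eq, DFunLike.coe_fn_eq] at he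
    rwa [he.1, he.2]
  · exact eqvGen_delRel_of_reflTransGen
end

section
/- Fix integers r ≥ 0, g ≥ 1 and d, and let t = (λ^1, ρ^1, …, λ^g, ρ^g) be a sequence of nonincreasing (r+1)-tuples of integers. Define α^n_i = (n−1) − λ^n_i and β^n_i = ρ^n_{r−i} − (n−d+r) for 1 ≤ n ≤ g and 0 ≤ i ≤ r. Then t is a pontableau sequence if and only if both of the following hold: (1) α^{n+1}_i + β^n_{r−i} ≥ d−r for all 0 ≤ i ≤ r and 1 ≤ n ≤ g−1; and (2) for each 1 ≤ n ≤ g, α^n_i + β^n_{r−i} ≤ d−r for all 0 ≤ i ≤ r, with equality for at most one value of i. -/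
namespace Pont

/-- The set of boxes of a nonincreasing `(r+1)`-tuple `l`: all `(x,y)` with `x < l y`. -/
def boxes (r : ℕ) (l : Fin (r + 1) → ℤ) : Set (ℤ × Fin (r + 1)) := {b | b.1 < l b.2}

/-- `b` is an inward corner of `l`: a minimal box not in `l` for the componentwise order. -/
def IsInwardCorner (r : ℕ) (l : Fin (r + 1) → ℤ) (b : ℤ × Fin (r + 1)) : Prop :=
  b ∉ boxes r l ∧ ∀ b' : ℤ × Fin (r + 1), b' ∉ boxes r l → b'.1 ≤ b.1 → b'.2 ≤ b.2 → b' = b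

/-- `l ∪ b`: the tuple obtained by increasing `l` by `1` in the row of `b`. -/
def addBox (r : ℕ) (l : Fin (r + 1) → ℤ) (b : ℤ × Fin (r + 1)) : Fin (r + 1) → ℤ :=
  fun y => if y = b.2 then l y + 1 else l y

end Pont

namespace Pont

theorem boxes_subset_iff {r : ℕ} {l m : Fin (r + 1) → ℤ} :
    boxes r l ⊆ boxes r m ↔ ∀ i, l i ≤ m i := by
  constructor
  · intro h i
    have hi : (l i - 1, i) ∈ boxes r l → (l i - 1, i) ∈ boxes r m := fun hb => h hb
    simp only [boxes, Set.mem_ofPred_eq] at hi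
    omega
  · rintro h ⟨x, y⟩ hb
    exact lt_of_lt_of_le hb (h y)

/-- The box after the end of row `i` is an inward corner as soon as all earlier rows are
strictly longer. -/
theorem isInwardCorner_of_forall_lt {r : ℕ} {l : Fin (r + 1) → ℤ} {i : Fin (r + 1)}
    (h : ∀ j < i, l i < l j) : IsInwardCorner r l (l i, i) := by
  refine ⟨by simp [boxes], ?_⟩
  rintro ⟨x, j⟩ hb hx hj
  simp only [boxes, Set.mem_ofPred_eq, not_lt] at hb hx hj
  rcases hj.lt_or_eq with hlt | rfl
  · have := h j hlt
    omega
  · rw [le_antisymm hx hb]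

theorem subset_or_exists_corner_iff {r : ℕ} {l m : Fin (r + 1) → ℤ} (hm : Antitone m) :
    (boxes r m ⊆ boxes r l ∨
      ∃ b, IsInwardCorner r l b ∧ boxes r m ⊆ boxes r (addBox r l b)) ↔
    (∀ i, m i ≤ l i + 1) ∧ ∀ i j, m i = l i + 1 → m j = l j + 1 → i = j := by
  simp only [boxes_subset_iff]
  constructor
  · rintro (h | ⟨b, -, h⟩)
    · refine ⟨fun i => ?_, fun i _ hi _ => ?_⟩ <;> have := h i <;> omega
    · have key : ∀ i, m i = l i + 1 → i = b.2 := by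
        intro i hi
        by_contra hne
        have := h i
        simp only [addBox, hne, if_false] at this
        omega
      refine ⟨fun i => ?_, fun i j hi hj => (key i hi).trans (key j hj).symm⟩
      have := h i
      unfold addBox at this
      split_ifs at this <;> omega
  · rintro ⟨hle, huniq⟩
    by_cases hex : ∃ i, m i = l i + 1
    · obtain ⟨i, hi⟩ := hex
      refine Or.inr ⟨(l i, i), isInwardCorner_of_forall_lt fun j hj => ?_, fun j => ?_⟩
      · by_contra hlt
        have h₁ := hm hj.le
        have h₂ := hle j
        exact hj.ne (huniq j i (by omega) hi)
      · have h₁ := hle j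
        have h₂ := huniq j i
        unfold addBox
        split_ifs with hji
        · exact h₁
        · have : m j ≠ l j + 1 := fun hj => hji (h₂ hj hi)
          omega
    · push Not at hex
      exact Or.inl fun i => by
        have h₁ := hle i
        have h₂ := hex i
        omega

end Pont

open Pont in
/-- **Observation.**  A sequence `(λ¹, ρ¹, …, λᵍ, ρᵍ)` of nonincreasing `(r+1)`-tuples
is a pontableau sequence iff, setting `α^n_i = (n−1) − λ^n_i` and
`β^n_i = ρ^n_{r−i} − (n−d+r)`, we have (1) `α^{n+1}_i + β^n_{r−i} ≥ d−r` for all `i` and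
`1 ≤ n ≤ g−1`, and (2) for each `1 ≤ n ≤ g`, `α^n_i + β^n_{r−i} ≤ d−r` for all `i` with
equality for at most one `i`. -/
theorem stmt_13 (r g : ℕ) (hg : 1 ≤ g) (d : ℤ)
    (lam rho : ℕ → Fin (r + 1) → ℤ)
    (hmono : ∀ n, 1 ≤ n → n ≤ g → Antitone (lam n) ∧ Antitone (rho n)) :
    let alf : ℕ → Fin (r + 1) → ℤ := fun n i => (n : ℤ) - 1 - lam n i
    let bet : ℕ → Fin (r + 1) → ℤ := fun n i => rho n i.rev - ((n : ℤ) - d + r)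
    ((∀ n, 1 ≤ n → n + 1 ≤ g → boxes r (lam (n + 1)) ⊆ boxes r (rho n)) ∧
     (∀ n, 1 ≤ n → n ≤ g →
        boxes r (rho n) ⊆ boxes r (lam n) ∨
          ∃ b, IsInwardCorner r (lam n) b ∧
            boxes r (rho n) ⊆ boxes r (addBox r (lam n) b)))
    ↔
    ((∀ n : ℕ, 1 ≤ n → n + 1 ≤ g → ∀ i : Fin (r + 1),
        alf (n + 1) i + bet n i.rev ≥ d - r) ∧
     (∀ n : ℕ, 1 ≤ n → n ≤ g →
        (∀ i : Fin (r + 1), alf n i + bet n i.rev ≤ d - r) ∧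
        (∀ i i' : Fin (r + 1), alf n i + bet n i.rev = d - r →
          alf n i' + bet n i'.rev = d - r → i = i'))) := by
  intro alf bet
  have hsucc : ∀ n i, alf (n + 1) i + bet n i.rev ≥ d - r ↔ lam (n + 1) i ≤ rho n i := by
    intro n i
    simp only [alf, bet, Fin.rev_rev]
    push_cast
    omega
  have hle : ∀ n i, alf n i + bet n i.rev ≤ d - r ↔ rho n i ≤ lam n i + 1 := by
    intro n i
    simp only [alf, bet, Fin.rev_rev]
    omega
  have heq : ∀ n i, alf n i + bet n i.rev = d - r ↔ rho n i = lam n i + 1 := by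
    intro n i
    simp only [alf, bet, Fin.rev_rev]
    omega
  simp only [hsucc, hle, heq, boxes_subset_iff (l := lam _)]
  refine and_congr_right fun _ => forall_congr' fun n => forall₂_congr fun h1 hn => ?_
  exact subset_or_exists_corner_iff (hmono n h1 hn).2
end

section
/- Under hypotheses (1)–(3) on the family a^{i,j,k}, for all integers 1 ≤ i, j, k ≤ d the following identity holds: (a^{i−1,j−1,k−1} − a^{i−1,j−1,k})·(a^{i−1,j−1,k} − a^{i,j−1,k} − a^{i−1,j,k} + a^{i,j,k}) + (a^{i,j,k−1} − a^{i,j,k})·(a^{i−1,j−1,k−1} − a^{i,j−1,k−1} − a^{i−1,j,k−1} + a^{i,j,k−1}) + (a^{i−1,j,k−1} − a^{i,j,k−1})·(a^{i,j−1,k−1} − a^{i,j,k−1}) − (a^{i−1,j,k} − a^{i,j,k})·(a^{i,j−1,k} − a^{i,j,k}) = (a^{i−1,j−1,k} − a^{i−1,j,k})·(a^{i−1,j,k−1} − a^{i−1,j,k}) − (a^{i,j−1,k} − a^{i,j,k})·(a^{i,j,k−1} − a^{i,j,k}) + (a^{i−1,j−1,k} − a^{i,j−1,k})·(a^{i,j−1,k−1}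 − a^{i,j−1,k}) − (a^{i−1,j,k} − a^{i,j,k})·(a^{i,j,k−1} − a^{i,j,k}). -/
/-- A function of two variables that is antitone in each on `[0, d]`, equals `1` at the origin and
vanishes when its first variable is `d`, takes only the values `0` and `1` there. -/
theorem eq_zero_or_one_of_antitone_steps {d : ℕ} {f : ℕ → ℕ → ℤ} (h0 : f 0 0 = 1)
    (hd : ∀ k, f d k = 0) (hfst : ∀ j k, j < d → k ≤ d → f (j + 1) k ≤ f j k)
    (hsnd : ∀ j k, j ≤ d → k < d → f j (k + 1) ≤ f j k) {j k : ℕ} (hj : j ≤ d) (hk : k ≤ d) :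
    f j k = 0 ∨ f j k = 1 := by
  have hrow : ∀ k, k ≤ d → f 0 k ≤ 1 := by
    intro k
    induction k with
    | zero => intro _; exact h0.le
    | succ k ih => intro h; exact (hsnd 0 k (Nat.zero_le d) h).trans (ih (by omega))
  have hle : f j k ≤ 1 := by
    induction j with
    | zero => exact hrow k hk
    | succ j ih => exact (hfst j k hj hk).trans (ih (by omega))
  have hge : 0 ≤ f j k := by
    induction hj using Nat.decreasingInduction with
    | self => exact (hd k).ge
    | of_succ j h ih => exact (ih (by have := hfst j k h hk; omega)).trans (hfst j k h hk)
  omega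

/-- The polynomial identity for the eight values on a unit cube whose decrements along edges are
`0` or `1` and whose faces are submodular; `pᵢⱼₖ` is the value at the vertex `(i, j, k)`. -/
theorem cube_identity {p000 p100 p010 p110 p001 p101 p011 p111 : ℤ}
    (e1 : p110 - p111 = 0 ∨ p110 - p111 = 1) (e2 : p101 - p111 = 0 ∨ p101 - p111 = 1)
    (e3 : p011 - p111 = 0 ∨ p011 - p111 = 1) (e4 : p100 - p110 = 0 ∨ p100 - p110 = 1)
    (e5 : p010 - p110 = 0 ∨ p010 - p110 = 1) (e6 : p001 - p101 = 0 ∨ p001 - p101 = 1)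
    (e7 : p000 - p100 = 0 ∨ p000 - p100 = 1) (e8 : p100 - p101 = 0 ∨ p100 - p101 = 1)
    (e9 : p010 - p011 = 0 ∨ p010 - p011 = 1) (e10 : p001 - p011 = 0 ∨ p001 - p011 = 1)
    (e11 : p000 - p010 = 0 ∨ p000 - p010 = 1) (e12 : p000 - p001 = 0 ∨ p000 - p001 = 1)
    (s1 : p100 + p010 ≤ p000 + p110) (s2 : p100 + p001 ≤ p000 + p101)
    (s3 : p010 + p001 ≤ p000 + p011) (s4 : p101 + p011 ≤ p001 + p111)
    (s5 : p110 + p011 ≤ p010 + p111) (s6 : p110 + p101 ≤ p100 + p111) :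
    (p000 - p001) * (p001 - p101 - p011 + p111) + (p110 - p111) * (p000 - p100 - p010 + p110) +
      (p010 - p110) * (p100 - p110) - (p011 - p111) * (p101 - p111) =
    (p001 - p011) * (p010 - p011) - (p101 - p111) * (p110 - p111) +
      (p001 - p101) * (p100 - p101) - (p011 - p111) * (p110 - p111) := by
  obtain ⟨x1, rfl⟩ : ∃ x, p110 = p111 + x := ⟨p110 - p111, by ring⟩
  obtain ⟨x2, rfl⟩ : ∃ x, p101 = p111 + x := ⟨p101 - p111, by ring⟩
  obtain ⟨x3, rfl⟩ : ∃ x, p011 = p111 + x := ⟨p011 - p111, by ring⟩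
  obtain ⟨x4, rfl⟩ : ∃ x, p100 = p111 + x := ⟨p100 - p111, by ring⟩
  obtain ⟨x5, rfl⟩ : ∃ x, p010 = p111 + x := ⟨p010 - p111, by ring⟩
  obtain ⟨x6, rfl⟩ : ∃ x, p001 = p111 + x := ⟨p001 - p111, by ring⟩
  obtain ⟨x7, rfl⟩ : ∃ x, p000 = p111 + x := ⟨p000 - p111, by ring⟩
  simp only [add_sub_cancel_left, add_sub_add_left_eq_sub] at *
  rcases e1 with rfl | rfl <;> rcases e2 with rfl | rfl <;> rcases e3 with rfl | rfl <;>
  rcases e4 with e4 | e4 <;> obtain rfl := eq_add_of_sub_eq e4 <;> try omega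
  all_goals
    rcases e5 with e5 | e5 <;> obtain rfl := eq_add_of_sub_eq e5 <;> try omega
  all_goals
    rcases e6 with e6 | e6 <;> obtain rfl := eq_add_of_sub_eq e6 <;> omega

/-- **Identity in the proof of Lemma A.2.**  Let `a^{i,j,k}` (for `0 ≤ i,j,k ≤ d`,
extended by `0` beyond `d`) be nonnegative integers satisfying the boundary conditions
and submodularity.  Then for all `1 ≤ i,j,k ≤ d` the stated five-term identity holds. -/
theorem stmt_17 (d : ℕ) (hd : 1 ≤ d) (a : ℕ → ℕ → ℕ → ℤ)
    (hnn : ∀ i j k, 0 ≤ a i j k)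
    (hext : ∀ i j k, d < i ∨ d < j ∨ d < k → a i j k = 0)
    (h1 : ∀ i, i ≤ d → a i 0 0 = (d : ℤ) - i ∧ a 0 i 0 = (d : ℤ) - i ∧ a 0 0 i = (d : ℤ) - i)
    (h2 : ∀ i j k, i = d ∨ j = d ∨ k = d → a i j k = 0)
    (h3 : ∀ i j k, i ≤ d → j ≤ d → k ≤ d →
      a (i + 1) j k + a i (j + 1) k ≤ a i j k + a (i + 1) (j + 1) k ∧
      a (i + 1) j k + a i j (k + 1) ≤ a i j k + a (i + 1) j (k + 1) ∧
      a i (j + 1) k + a i j (k + 1) ≤ a i j k + a i (j + 1) (k + 1))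
    (i j k : ℕ) (hi1 : 1 ≤ i) (hi2 : i ≤ d) (hj1 : 1 ≤ j) (hj2 : j ≤ d)
    (hk1 : 1 ≤ k) (hk2 : k ≤ d) :
    (a (i-1) (j-1) (k-1) - a (i-1) (j-1) k) *
        (a (i-1) (j-1) k - a i (j-1) k - a (i-1) j k + a i j k) +
      (a i j (k-1) - a i j k) *
        (a (i-1) (j-1) (k-1) - a i (j-1) (k-1) - a (i-1) j (k-1) + a i j (k-1)) +
      (a (i-1) j (k-1) - a i j (k-1)) * (a i (j-1) (k-1) - a i j (k-1)) -
      (a (i-1) j k - a i j k) * (a i (j-1) k - a i j k) =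
    (a (i-1) (j-1) k - a (i-1) j k) * (a (i-1) j (k-1) - a (i-1) j k) -
      (a i (j-1) k - a i j k) * (a i j (k-1) - a i j k) +
      (a (i-1) (j-1) k - a i (j-1) k) * (a i (j-1) (k-1) - a i (j-1) k) -
      (a (i-1) j k - a i j k) * (a i j (k-1) - a i j k) := by
  obtain ⟨i, rfl⟩ := Nat.exists_eq_add_of_le' hi1
  obtain ⟨j, rfl⟩ := Nat.exists_eq_add_of_le' hj1
  obtain ⟨k, rfl⟩ := Nat.exists_eq_add_of_le' hk1
  simp only [Nat.add_sub_cancel]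
  have hI : ∀ y z, y ≤ d → z ≤ d → a i y z - a (i + 1) y z = 0 ∨ a i y z - a (i + 1) y z = 1 := by
    intro y z hy hz
    refine eq_zero_or_one_of_antitone_steps (f := fun y z => a i y z - a (i + 1) y z)
      ?_ ?_ ?_ ?_ hy hz
    · have := (h1 i (by omega)).1
      have := (h1 (i + 1) hi2).1
      push_cast at *
      linarith
    · intro z; simp [h2]
    · intro y z hy hz; have := (h3 i y z (by omega) hy.le hz).1; linarith
    · intro y z hy hz; have := (h3 i y z (by omega) hy hz.le).2.1; linarith
  have hJ : ∀ x z, x ≤ d → z ≤ d → a x j z - a x (j + 1) z = 0 ∨ a x j z - a x (j + 1) z = 1 := by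
    intro x z hx hz
    refine eq_zero_or_one_of_antitone_steps (f := fun x z => a x j z - a x (j + 1) z)
      ?_ ?_ ?_ ?_ hx hz
    · have := (h1 j (by omega)).2.1
      have := (h1 (j + 1) hj2).2.1
      push_cast at *
      linarith
    · intro z; simp [h2]
    · intro x z hx hz; have := (h3 x j z hx.le (by omega) hz).1; linarith
    · intro x z hx hz; have := (h3 x j z hx (by omega) hz.le).2.2; linarith
  have hK : ∀ x y, x ≤ d → y ≤ d → a x y k - a x y (k + 1) = 0 ∨ a x y k - a x y (k + 1) = 1 := by
    intro x y hx hy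
    refine eq_zero_or_one_of_antitone_steps (f := fun x y => a x y k - a x y (k + 1))
      ?_ ?_ ?_ ?_ hx hy
    · have := (h1 k (by omega)).2.2
      have := (h1 (k + 1) hk2).2.2
      push_cast at *
      linarith
    · intro y; simp [h2]
    · intro x y hx hy; have := (h3 x y k hx.le hy (by omega)).2.1; linarith
    · intro x y hx hy; have := (h3 x y k hx hy.le (by omega)).2.2; linarith
  have hi : i ≤ d := by omega
  have hj : j ≤ d := by omega
  have hk : k ≤ d := by omega
  exact cube_identity (hK _ _ hi2 hj2) (hJ _ _ hi2 hk2) (hI _ _ hj2 hk2) (hJ _ _ hi2 hk)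
    (hI _ _ hj2 hk) (hI _ _ hj hk2) (hI _ _ hj hk) (hK _ _ hi2 hj) (hK _ _ hi hj2)
    (hJ _ _ hi hk2) (hJ _ _ hi hk) (hK _ _ hi hj)
    (h3 i j k hi hj hk).1 (h3 i j k hi hj hk).2.1 (h3 i j k hi hj hk).2.2
    (h3 i j (k + 1) hi hj hk2).1 (h3 i (j + 1) k hi hj2 hk).2.1 (h3 (i + 1) j k hi2 hj hk).2.2
end

section
/- Under hypotheses (1)–(3) on the family a^{i,j,k}: for all integers 0 ≤ i' ≤ i ≤ d, 0 ≤ j' ≤ j ≤ d, and 0 ≤ k < d, one has a^{i,j,k} − a^{i,j,k+1} ≤ a^{i',j',k} − a^{i',j',k+1}; in particular 0 ≤ a^{i,j,k} − a^{i,j,k+1} ≤ 1 for all 0 ≤ i,j ≤ d and 0 ≤ k < d. The analogous statements hold with the roles of the three indices permuted. -/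
/-- A function on a square grid that decreases along unit steps in each coordinate is
antitone in both coordinates. -/
theorem le_of_grid_steps {d : ℕ} {g : ℕ → ℕ → ℤ}
    (hl : ∀ i j, i < d → j ≤ d → g (i + 1) j ≤ g i j)
    (hr : ∀ i j, i ≤ d → j < d → g i (j + 1) ≤ g i j)
    {i' i j' j : ℕ} (hi : i' ≤ i) (hid : i ≤ d) (hj : j' ≤ j) (hjd : j ≤ d) :
    g i j ≤ g i' j' := by
  have hleft : g i j ≤ g i' j := by
    induction i, hi using Nat.le_induction with
    | base => exact le_rfl
    | succ n _ ih => exact (hl n j (by omega) hjd).trans (ih (by omega))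
  have hright : g i' j ≤ g i' j' := by
    clear hleft
    induction j, hj using Nat.le_induction with
    | base => exact le_rfl
    | succ n _ ih => exact (hr i' n (by omega) (by omega)).trans (ih (by omega))
  exact hleft.trans hright

/-- **Consequences of submodularity.**  Under the hypotheses on the family `a^{i,j,k}`:
for `i' ≤ i ≤ d`, `j' ≤ j ≤ d`, `k < d`, the difference `a^{i,j,k} − a^{i,j,k+1}` is
monotone (`≤ a^{i',j',k} − a^{i',j',k+1}`) and lies in `{0,1}`; and the analogous
statements hold with the roles of the three indices permuted. -/
theorem stmt_18 (d : ℕ) (hd : 1 ≤ d) (a : ℕ → ℕ → ℕ → ℤ)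
    (hnn : ∀ i j k, 0 ≤ a i j k)
    (hext : ∀ i j k, d < i ∨ d < j ∨ d < k → a i j k = 0)
    (h1 : ∀ i, i ≤ d → a i 0 0 = (d : ℤ) - i ∧ a 0 i 0 = (d : ℤ) - i ∧ a 0 0 i = (d : ℤ) - i)
    (h2 : ∀ i j k, i = d ∨ j = d ∨ k = d → a i j k = 0)
    (h3 : ∀ i j k, i ≤ d → j ≤ d → k ≤ d →
      a (i + 1) j k + a i (j + 1) k ≤ a i j k + a (i + 1) (j + 1) k ∧
      a (i + 1) j k + a i j (k + 1) ≤ a i j k + a (i + 1) j (k + 1) ∧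
      a i (j + 1) k + a i j (k + 1) ≤ a i j k + a i (j + 1) (k + 1)) :
    ((∀ i' i j' j k : ℕ, i' ≤ i → i ≤ d → j' ≤ j → j ≤ d → k < d →
        a i j k - a i j (k + 1) ≤ a i' j' k - a i' j' (k + 1)) ∧
     (∀ i j k : ℕ, i ≤ d → j ≤ d → k < d →
        0 ≤ a i j k - a i j (k + 1) ∧ a i j k - a i j (k + 1) ≤ 1)) ∧
    ((∀ j' j k' k i : ℕ, j' ≤ j → j ≤ d → k' ≤ k → k ≤ d → i < d →
        a i j k - a (i + 1) j k ≤ a i j' k' - a (i + 1) j' k') ∧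
     (∀ i j k : ℕ, j ≤ d → k ≤ d → i < d →
        0 ≤ a i j k - a (i + 1) j k ∧ a i j k - a (i + 1) j k ≤ 1)) ∧
    ((∀ i' i k' k j : ℕ, i' ≤ i → i ≤ d → k' ≤ k → k ≤ d → j < d →
        a i j k - a i (j + 1) k ≤ a i' j k' - a i' (j + 1) k') ∧
     (∀ i j k : ℕ, i ≤ d → k ≤ d → j < d →
        0 ≤ a i j k - a i (j + 1) k ∧ a i j k - a i (j + 1) k ≤ 1)) := by
  have hk : ∀ i' i j' j k : ℕ, i' ≤ i → i ≤ d → j' ≤ j → j ≤ d → k < d →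
      a i j k - a i j (k + 1) ≤ a i' j' k - a i' j' (k + 1) := by
    intro i' i j' j k hi hid hj hjd hkd
    refine le_of_grid_steps (d := d) (g := fun i j => a i j k - a i j (k + 1)) ?_ ?_ hi hid hj hjd
    · intro i j hi hj
      linarith [(h3 i j k hi.le hj hkd.le).2.1]
    · intro i j hi hj
      linarith [(h3 i j k hi hj.le hkd.le).2.2]
  have hi : ∀ j' j k' k i : ℕ, j' ≤ j → j ≤ d → k' ≤ k → k ≤ d → i < d →
      a i j k - a (i + 1) j k ≤ a i j' k' - a (i + 1) j' k' := by
    intro j' j k' k i hj hjd hk hkd hid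
    refine le_of_grid_steps (d := d) (g := fun j k => a i j k - a (i + 1) j k) ?_ ?_ hj hjd hk hkd
    · intro j k hj hk
      linarith [(h3 i j k hid.le hj.le hk).1]
    · intro j k hj hk
      linarith [(h3 i j k hid.le hj hk.le).2.1]
  have hj : ∀ i' i k' k j : ℕ, i' ≤ i → i ≤ d → k' ≤ k → k ≤ d → j < d →
      a i j k - a i (j + 1) k ≤ a i' j k' - a i' (j + 1) k' := by
    intro i' i k' k j hi hid hk hkd hjd
    refine le_of_grid_steps (d := d) (g := fun i k => a i j k - a i (j + 1) k) ?_ ?_ hi hid hk hkd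
    · intro i k hi hk
      linarith [(h3 i j k hi.le hjd.le hk).1]
    · intro i k hi hk
      linarith [(h3 i j k hi hjd.le hk.le).2.2]
  refine ⟨⟨hk, fun i j k hid hjd hkd => ⟨?_, ?_⟩⟩, ⟨hi, fun i j k hjd hkd hid => ⟨?_, ?_⟩⟩,
    ⟨hj, fun i j k hid hkd hjd => ⟨?_, ?_⟩⟩⟩
  · linarith [hk i d j j k hid le_rfl le_rfl hjd hkd, h2 d j k (.inl rfl), h2 d j (k + 1) (.inl rfl)]
  · have h := (h1 (k + 1) hkd).2.2
    push_cast at h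
    linarith [hk 0 i 0 j k i.zero_le hid j.zero_le hjd hkd, (h1 k hkd.le).2.2]
  · linarith [hi j d k k i hjd le_rfl le_rfl hkd hid, h2 i d k (.inr (.inl rfl)),
      h2 (i + 1) d k (.inr (.inl rfl))]
  · have h := (h1 (i + 1) hid).1
    push_cast at h
    linarith [hi 0 j 0 k i j.zero_le hjd k.zero_le hkd hid, (h1 i hid.le).1]
  · linarith [hj i d k k j hid le_rfl le_rfl hkd hjd, h2 d j k (.inl rfl), h2 d (j + 1) k (.inl rfl)]
  · have h := (h1 (j + 1) hjd).2.1
    push_cast at h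
    linarith [hj 0 i 0 k j i.zero_le hid k.zero_le hkd hjd, (h1 j hjd.le).2.1]
end

section
/- Suppose the family a^{i,j,k} satisfies hypotheses (1)–(3), and in addition there is an integer t with 1 ≤ t ≤ d−1 such that for all 0 ≤ i,j ≤ d: a^{i,j,0} = d − i − j if i + j < d, a^{i,j,0} = 1 if (i,j) = (t, d−t), and a^{i,j,0} = 0 otherwise; and suppose moreover that a^{i,0,k} + a^{0,d−i,k} ≤ a^{0,0,k} for all 0 ≤ i ≤ d and 0 ≤ k ≤ d. Then there exist integers i, j, k with 1 ≤ i ≤ t, 1 ≤ j ≤ d−t, and 1 ≤ k ≤ d such that a^{i,j,k−1} − a^{i,j,k} > 0 and a^{i−1,j−1,k−1} − a^{i,j−1,k−1} − a^{i−1,j,k−1} + a^{i,j,k−1} > 0. -/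
/-- A nonpositive mixed second difference on a box gives the inequality at its corners. -/
theorem corner_sum_le_of_mixed_diff_nonpos (f : ℕ → ℕ → ℤ) (m n : ℕ)
    (h : ∀ i < m, ∀ j < n, f i j - f (i + 1) j - f i (j + 1) + f (i + 1) (j + 1) ≤ 0) :
    f 0 0 + f m n ≤ f m 0 + f 0 n := by
  have row : ∀ i < m, ∀ j ≤ n, f i 0 + f (i + 1) j ≤ f (i + 1) 0 + f i j := by
    intro i hi j
    induction j with
    | zero => intro _; linarith
    | succ j ih =>
      intro hj
      linarith [ih (by omega), h i hi j (by omega)]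
  have col : ∀ i ≤ m, f 0 0 + f i n ≤ f i 0 + f 0 n := by
    intro i
    induction i with
    | zero => intro _; linarith
    | succ i ih =>
      intro hi
      linarith [ih (by omega), row i (by omega) n le_rfl]
  exact col m le_rfl

/-- A function taking a smaller value at `n` than at `0` drops at some step before `n`. -/
theorem exists_succ_lt_of_lt_zero (f : ℕ → ℤ) (n : ℕ) (h : f n < f 0) :
    ∃ k < n, f (k + 1) < f k := by
  by_contra! hc
  have key : ∀ k ≤ n, f 0 ≤ f k := by
    intro k
    induction k with
    | zero => intro _; exact le_rfl
    | succ k ih => intro hk; exact (ih (by omega)).trans (hc k (by omega))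
  exact absurd (key n le_rfl) (not_le.mpr h)

/-- **Lemma (almost-transverse case).**  Suppose the family `a^{i,j,k}` satisfies the
standard hypotheses, that for some `1 ≤ t ≤ d−1` the values `a^{i,j,0}` are those of an
almost-transverse pair of flags with special index `t`, and that the coherence
inequality `a^{i,0,k} + a^{0,d−i,k} ≤ a^{0,0,k}` holds.  Then there exist
`1 ≤ i ≤ t`, `1 ≤ j ≤ d−t`, `1 ≤ k ≤ d` with `a^{i,j,k−1} − a^{i,j,k} > 0` and
`a^{i−1,j−1,k−1} − a^{i,j−1,k−1} − a^{i−1,j,k−1} + a^{i,j,k−1} > 0`. -/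
theorem stmt_19 (d : ℕ) (hd : 1 ≤ d) (a : ℕ → ℕ → ℕ → ℤ)
    (hnn : ∀ i j k, 0 ≤ a i j k)
    (hext : ∀ i j k, d < i ∨ d < j ∨ d < k → a i j k = 0)
    (h1 : ∀ i, i ≤ d → a i 0 0 = (d : ℤ) - i ∧ a 0 i 0 = (d : ℤ) - i ∧ a 0 0 i = (d : ℤ) - i)
    (h2 : ∀ i j k, i = d ∨ j = d ∨ k = d → a i j k = 0)
    (h3 : ∀ i j k, i ≤ d → j ≤ d → k ≤ d →
      a (i + 1) j k + a i (j + 1) k ≤ a i j k + a (i + 1) (j + 1) k ∧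
      a (i + 1) j k + a i j (k + 1) ≤ a i j k + a (i + 1) j (k + 1) ∧
      a i (j + 1) k + a i j (k + 1) ≤ a i j k + a i (j + 1) (k + 1))
    (t : ℕ) (ht1 : 1 ≤ t) (ht2 : t ≤ d - 1)
    (hval : ∀ i j, i ≤ d → j ≤ d →
      a i j 0 = if i + j < d then (d : ℤ) - i - j
        else if i = t ∧ j = d - t then 1 else 0)
    (hcoh : ∀ i k, i ≤ d → k ≤ d → a i 0 k + a 0 (d - i) k ≤ a 0 0 k) :
    ∃ i j k : ℕ, 1 ≤ i ∧ i ≤ t ∧ 1 ≤ j ∧ j ≤ d - t ∧ 1 ≤ k ∧ k ≤ d ∧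
      0 < a i j (k - 1) - a i j k ∧
      0 < a (i - 1) (j - 1) (k - 1) - a i (j - 1) (k - 1) -
            a (i - 1) j (k - 1) + a i j (k - 1) := by
  obtain ⟨k, hk, hdrop⟩ := exists_succ_lt_of_lt_zero (fun k => a t (d - t) k) d (by
    have e0 := hval t (d - t) (by omega) (by omega)
    rw [if_neg (by omega), if_pos ⟨rfl, rfl⟩] at e0
    simp only [h2 t (d - t) d (by simp), e0, zero_lt_one])
  have hpos : ∃ i < t, ∃ j < d - t,
      0 < a i j k - a (i + 1) j k - a i (j + 1) k + a (i + 1) (j + 1) k := by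
    by_contra! hc
    have hbox := corner_sum_le_of_mixed_diff_nonpos (fun i j => a i j k) t (d - t) hc
    have hct := hcoh t k (by omega) hk.le
    have hnext := hnn t (d - t) (k + 1)
    beta_reduce at hbox hdrop
    linarith
  obtain ⟨i, hi, j, hj, hP⟩ := hpos
  have hanti₁ : AntitoneOn (fun i => a i (d - t) k - a i (d - t) (k + 1)) (Set.Icc 0 d) :=
    antitoneOn_of_succ_le Set.ordConnected_Icc fun i _ hi _ => by
      have := (h3 i (d - t) k hi.2 (by omega) hk.le).2.1
      simp only [Nat.succ_eq_succ, Nat.succ_eq_add_one]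
      linarith
  have hanti₂ : AntitoneOn (fun j => a (i + 1) j k - a (i + 1) j (k + 1)) (Set.Icc 0 d) :=
    antitoneOn_of_succ_le Set.ordConnected_Icc fun j _ hj _ => by
      have := (h3 (i + 1) j k (by omega) hj.2 hk.le).2.2
      simp only [Nat.succ_eq_succ, Nat.succ_eq_add_one]
      linarith
  have e₁ := hanti₁ (a := i + 1) (b := t) ⟨by omega, by omega⟩ ⟨by omega, by omega⟩ hi
  have e₂ := hanti₂ (a := j + 1) (b := d - t) ⟨by omega, by omega⟩ ⟨by omega, by omega⟩ hj
  refine ⟨i + 1, j + 1, k + 1, by omega, hi, by omega, hj, by omega, hk, ?_, ?_⟩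
  · simp only [Nat.add_sub_cancel] at *
    linarith
  · simpa only [Nat.add_sub_cancel] using hP
end
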